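/- arXiv:2004.09383 — 2 statements merged into one kernel-verified Lean document; each statement's English description precedes it below -/
import Mathlib

section
/- Let f be meromorphic on ℂ with pole set P and let K ⊆ ℂ be a compact set. Then there exists a constant M ≥ 0 such that for all z ∈ K \ P, the spherical derivative satisfies ‖f′(z)‖ / (1 + ‖f(z)‖²) ≤ M. -/
open Filter Topology

lemma AnalyticAt.exists_eventually_norm_deriv_le {g : ℂ → ℂ} {c : ℂ} (hg : AnalyticAt ℂ g c) :
    ∃ M : ℝ, ∀ᶠ z in 𝓝 c, ‖deriv g z‖ ≤ M :=
  ⟨‖deriv g c‖ + 1, (hg.deriv.continuousAt.norm.eventually_lt continuousAt_const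
    (lt_add_one _)).mono fun _ h => h.le⟩

lemma norm_deriv_div_one_add_sq_le {f : ℂ → ℂ} {z : ℂ} :
    ‖deriv f z‖ / (1 + ‖f z‖ ^ 2) ≤ ‖deriv f z‖ :=
  div_le_self (norm_nonneg _) (le_add_of_nonneg_right (sq_nonneg _))

/-- The spherical derivative of `f` is at most `‖(1 / f)′‖`. -/
lemma norm_deriv_div_one_add_sq_le_norm_deriv_inv {f : ℂ → ℂ} {z : ℂ}
    (hf : DifferentiableAt ℂ f z) (hz : f z ≠ 0) :
    ‖deriv f z‖ / (1 + ‖f z‖ ^ 2) ≤ ‖deriv (fun w => (f w)⁻¹) z‖ := by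
  rw [deriv_fun_inv'' hf hz, norm_div, norm_neg, norm_pow]
  have : 0 < ‖f z‖ := norm_pos_iff.2 hz
  gcongr
  linarith

/-- If `f` has a pole at `p`, the function `1 / f`, extended by `0` at `p`, is analytic at `p`. -/
lemma analyticAt_update_inv_of_tendsto_norm_atTop {f : ℂ → ℂ} {p : ℂ}
    (hd : ∀ᶠ z in 𝓝[≠] p, DifferentiableAt ℂ f z)
    (hp : Tendsto (fun z => ‖f z‖) (𝓝[≠] p) atTop) :
    AnalyticAt ℂ (Function.update (fun z => (f z)⁻¹) p 0) p := by
  apply Complex.analyticAt_of_differentiable_on_punctured_nhds_of_continuousAt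
  · filter_upwards [hd, hp.eventually_gt_atTop 0, self_mem_nhdsWithin] with z hz h0 hne
    refine (hz.fun_inv (norm_pos_iff.1 h0)).congr_of_eventuallyEq ?_
    filter_upwards [isOpen_ne.mem_nhds hne] with w hw
    exact Function.update_of_ne hw _ _
  · rw [continuousAt_update_same]
    exact tendsto_inv₀_cobounded.comp (tendsto_norm_atTop_iff_cobounded.1 hp)

lemma exists_eventually_nhdsNE_spherical_derivative_le {f : ℂ → ℂ} {p : ℂ}
    (hd : ∀ᶠ z in 𝓝[≠] p, DifferentiableAt ℂ f z)
    (hp : Tendsto (fun z => ‖f z‖) (𝓝[≠] p) atTop) :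
    ∃ M : ℝ, ∀ᶠ z in 𝓝[≠] p, ‖deriv f z‖ / (1 + ‖f z‖ ^ 2) ≤ M := by
  obtain ⟨M, hM⟩ :=
    (analyticAt_update_inv_of_tendsto_norm_atTop hd hp).exists_eventually_norm_deriv_le
  refine ⟨M, ?_⟩
  filter_upwards [hd, hp.eventually_gt_atTop 0, self_mem_nhdsWithin,
    hM.filter_mono nhdsWithin_le_nhds] with z hz h0 hne hle
  refine (norm_deriv_div_one_add_sq_le_norm_deriv_inv hz (norm_pos_iff.1 h0)).trans ?_
  have heq : Function.update (fun z => (f z)⁻¹) p 0 =ᶠ[𝓝 z] fun z => (f z)⁻¹ := by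
    filter_upwards [isOpen_ne.mem_nhds hne] with w hw
    exact Function.update_of_ne hw _ _
  rwa [← heq.deriv_eq]

/-- Let `f` be meromorphic on `ℂ` with pole set `P` and let `K ⊆ ℂ` be compact.
Then there exists `M ≥ 0` bounding the spherical derivative
`‖f′ z‖ / (1 + ‖f z‖²)` on `K \ P`. -/
theorem spherical_derivative_bounded_on_compact
    (f : ℂ → ℂ) (P : Set ℂ)
    (hPclosed : IsClosed P)
    (hPdiscrete : ∀ z : ℂ, ¬ AccPt z (Filter.principal P))
    (hdiff : ∀ z ∈ Pᶜ, DifferentiableAt ℂ f z)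
    (hpole : ∀ p ∈ P,
      Filter.Tendsto (fun z => ‖f z‖) (nhdsWithin p {p}ᶜ) Filter.atTop)
    (K : Set ℂ) (hK : IsCompact K) :
    ∃ M : ℝ, 0 ≤ M ∧ ∀ z ∈ K \ P,
      ‖deriv f z‖ / (1 + ‖f z‖ ^ 2) ≤ M := by
  have hlocal : ∀ c : ℂ, ∃ M : ℝ, ∀ᶠ z in 𝓝 c, z ∉ P →
      ‖deriv f z‖ / (1 + ‖f z‖ ^ 2) ≤ M := by
    intro c
    by_cases hc : c ∈ P
    · have hd : ∀ᶠ z in 𝓝[≠] c, DifferentiableAt ℂ f z := by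
        have h := hPdiscrete c
        rw [accPt_iff_frequently_nhdsNE, not_frequently] at h
        exact h.mono hdiff
      obtain ⟨M, hM⟩ := exists_eventually_nhdsNE_spherical_derivative_le hd (hpole c hc)
      refine ⟨M, (eventually_nhdsWithin_iff.1 hM).mono fun z hz hzP => hz ?_⟩
      rintro rfl
      exact hzP hc
    · have hf : AnalyticAt ℂ f c :=
        DifferentiableOn.analyticAt (fun z hz => (hdiff z hz).differentiableWithinAt)
          (hPclosed.isOpen_compl.mem_nhds hc)
      obtain ⟨M, hM⟩ := hf.exists_eventually_norm_deriv_le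
      exact ⟨M, hM.mono fun z hz _ => norm_deriv_div_one_add_sq_le.trans hz⟩
  refine hK.induction_on (p := fun s => ∃ M : ℝ, 0 ≤ M ∧ ∀ z ∈ s \ P,
    ‖deriv f z‖ / (1 + ‖f z‖ ^ 2) ≤ M) ⟨0, le_rfl, by simp⟩ ?_ ?_ ?_
  · rintro s t hst ⟨M, hM0, hM⟩
    exact ⟨M, hM0, fun z hz => hM z ⟨hst hz.1, hz.2⟩⟩
  · rintro s t ⟨M, hM0, hM⟩ ⟨N, -, hN⟩
    refine ⟨max M N, le_max_of_le_left hM0, ?_⟩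
    rintro z ⟨hz | hz, hzP⟩
    · exact le_max_of_le_left (hM z ⟨hz, hzP⟩)
    · exact le_max_of_le_right (hN z ⟨hz, hzP⟩)
  · intro c _
    obtain ⟨M, hM⟩ := hlocal c
    exact ⟨_, mem_nhdsWithin_of_mem_nhds hM, max M 0, le_max_right _ _,
      fun z hz => le_max_of_le_left (hz.1 hz.2)⟩
end

section
/- Let f be meromorphic on ℂ with finite nonempty pole set P, suppose f is transcendental, and let p ∈ P be a pole of f that is not an omitted value, i.e. there exists w ∈ ℂ \ P with f(w) = p. Then for every sequence (ρ_k) of real numbers there exist a point z₀ ∈ ℂ whose full orbit is defined (f^[n](z₀) ∉ P for all n ∈ ℕ), a constant M ∈ ℕ, and strictly increasing sequences (m_k) and (n_k) of natural numbers with m_k < n_k < m_{k+1}, n_k − m_k ≤ M and m_{k+1} − n_k ≤ M for all k, such that f^[m_k](z₀) → p as k → ∞, ‖f^[n_k](z₀)‖ → ∞ as k → ∞, and moreover ‖f^[n_k](z₀)‖ ≥ ρ_k for every k. In particular, z₀ has a ping-pong orbit whose escaping subsequence escapes arbitrarily fast. -/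
open Metric Set Filter Topology

theorem ball_subset_image_ball_of_norm_deriv_le {g : ℂ → ℂ} {a : ℂ} {t : ℝ} (ht : 0 < t)
    (hg : DifferentiableOn ℂ g (ball a t)) (hga : deriv g a ≠ 0)
    (hb : ∀ z ∈ ball a t, ‖deriv g z‖ ≤ 2 * ‖deriv g a‖) :
    ball (g a) (‖deriv g a‖ * t / 24) ⊆ g '' ball a t := by
  set D := ‖deriv g a‖ with hD
  have hDpos : 0 < D := norm_pos_iff.2 hga
  have hgd : ∀ z ∈ ball a t, DifferentiableAt ℂ g z := fun z hz =>
    hg.differentiableAt (isOpen_ball.mem_nhds hz)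
  have hd' : DifferentiableOn ℂ (deriv g) (ball a t) := hg.deriv isOpen_ball
  have hmaps : MapsTo (deriv g) (ball a t) (closedBall (deriv g a) (3 * D)) := by
    intro z hz
    rw [mem_closedBall, dist_eq_norm]
    linarith [norm_sub_le (deriv g z) (deriv g a), hb z hz]
  have hsub : closedBall a (t / 6) ⊆ ball a t := closedBall_subset_ball (by linarith)
  have hclose : ∀ z ∈ closedBall a (t / 6), ‖deriv g z - deriv g a‖ ≤ D / 2 := by
    intro z hz
    have h := Complex.dist_le_div_mul_dist_of_mapsTo_ball hd' hmaps (hsub hz)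
    rw [dist_eq_norm] at h
    refine h.trans ?_
    have h2 : dist z a ≤ t / 6 := hz
    calc 3 * D / t * dist z a ≤ 3 * D / t * (t / 6) := by gcongr
      _ = D / 2 := by field_simp; norm_num
  have hlow : ∀ z ∈ closedBall a (t / 6), D / 2 * ‖z - a‖ ≤ ‖g z - g a‖ := by
    intro z hz
    have h := (convex_closedBall a (t / 6)).norm_image_sub_le_of_norm_hasDerivWithin_le
      (f := fun z => g z - deriv g a * z) (f' := fun z => deriv g z - deriv g a) (C := D / 2)
      (x := a) (y := z)
      (fun x hx => (by
        simpa using ((hgd x (hsub hx)).hasDerivAt.fun_sub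
          ((hasDerivAt_id' x).const_mul (deriv g a))).hasDerivWithinAt))
      hclose (mem_closedBall_self (by positivity)) hz
    have h3 : deriv g a * (z - a) =
        (g z - g a) - ((g z - deriv g a * z) - (g a - deriv g a * a)) := by ring
    have h4 := norm_sub_le (g z - g a) ((g z - deriv g a * z) - (g a - deriv g a * a))
    rw [← h3, norm_mul] at h4
    linarith
  have key := DiffContOnCl.ball_subset_image_closedBall (f := g) (z₀ := a) (r := t / 6)
    (ε := D * t / 12)
    ⟨hg.mono (ball_subset_closedBall.trans hsub),
      hg.continuousOn.mono (closure_ball_subset_closedBall.trans hsub)⟩ (by positivity)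
    (fun z hz => by
      have := hlow z (sphere_subset_closedBall hz)
      rw [mem_sphere_iff_norm.1 hz] at this
      linarith)
    (by
      have : ∀ᶠ z in 𝓝[≠] a, g z ≠ g a :=
        (hgd a (mem_ball_self ht)).hasDerivAt.eventually_ne hga
      exact this.frequently.filter_mono nhdsWithin_le_nhds)
  have hr : D * t / 12 / 2 = D * t / 24 := by ring
  rw [hr] at key
  exact key.trans (image_mono hsub)

/-- A weak form of **Bloch's theorem**. -/
theorem exists_ball_subset_image_ball {g : ℂ → ℂ} {c : ℂ} {r R : ℝ} (hr : 0 < r) (hrR : r < R)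
    (hg : DifferentiableOn ℂ g (ball c R)) :
    ∃ v, ball v (r * ‖deriv g c‖ / 48) ⊆ g '' ball c r := by
  by_cases hgc : deriv g c = 0
  · exact ⟨0, by simp [hgc]⟩
  have hsub : closedBall c r ⊆ ball c R := closedBall_subset_ball hrR
  have hcont : ContinuousOn (fun z => ‖deriv g z‖ * (r - dist z c)) (closedBall c r) :=
    ((hg.deriv isOpen_ball).continuousOn.mono hsub).norm.mul (by fun_prop)
  obtain ⟨a, ha, hmax⟩ := (isCompact_closedBall c r).exists_isMaxOn
    ⟨c, mem_closedBall_self hr.le⟩ hcont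
  have hmax' : ∀ z ∈ closedBall c r,
      ‖deriv g z‖ * (r - dist z c) ≤ ‖deriv g a‖ * (r - dist a c) := fun z hz => hmax hz
  have h0 := hmax' c (mem_closedBall_self hr.le)
  rw [dist_self, sub_zero] at h0
  have hpos : 0 < ‖deriv g a‖ * (r - dist a c) :=
    lt_of_lt_of_le (mul_pos (norm_pos_iff.2 hgc) hr) h0
  have ht : 0 < r - dist a c := pos_of_mul_pos_right hpos (norm_nonneg _)
  set t := (r - dist a c) / 2 with htdef
  have htpos : 0 < t := by positivity
  have hball : ball a t ⊆ ball c r := ball_subset_ball' (by linarith)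
  have hga : deriv g a ≠ 0 := by
    intro h
    simp [h] at hpos
  refine ⟨g a, Subset.trans (ball_subset_ball ?_) ((ball_subset_image_ball_of_norm_deriv_le htpos
    (hg.mono (hball.trans (ball_subset_closedBall.trans hsub))) hga ?_).trans (image_mono hball))⟩
  · rw [htdef]
    linarith
  · intro z hz
    have h1 := hmax' z (ball_subset_closedBall (hball hz))
    have h2 : t ≤ r - dist z c := by
      have := dist_triangle z a c
      have := mem_ball.1 hz
      linarith
    have h3 : ‖deriv g z‖ * t ≤ 2 * ‖deriv g a‖ * t := by
      calc ‖deriv g z‖ * t ≤ ‖deriv g z‖ * (r - dist z c) := by gcongr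
        _ ≤ _ := h1
        _ = _ := by rw [htdef]; ring
    exact le_of_mul_le_mul_right h3 htpos

theorem exists_eq_exp_of_ne_zero {F : ℂ → ℂ} {c : ℂ} {r : ℝ}
    (hF : DifferentiableOn ℂ F (ball c r)) (h0 : ∀ z ∈ ball c r, F z ≠ 0) (y : ℂ)
    (hy : Complex.exp y = F c) :
    ∃ h : ℂ → ℂ, DifferentiableOn ℂ h (ball c r) ∧ h c = y ∧
      ∀ z ∈ ball c r, F z = Complex.exp (h z) := by
  obtain ⟨h, hc, hh⟩ := ((hF.deriv isOpen_ball).div hF h0).isExactOn_ball.with_val_at c y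
  refine ⟨h, fun z hz => (hh z hz).differentiableAt.differentiableWithinAt, hc, fun z hz => ?_⟩
  have hder : ∀ x ∈ ball c r, HasDerivAt (fun z => F z * Complex.exp (-h z)) 0 x := by
    intro x hx
    have h1 := (hF.differentiableAt (isOpen_ball.mem_nhds hx)).hasDerivAt.fun_mul
      (hh x hx).fun_neg.cexp
    refine h1.congr_deriv ?_
    have := h0 x hx
    simp only [Pi.div_apply]
    field_simp
    ring
  have hr : 0 < r := nonempty_ball.1 ⟨z, hz⟩
  have hconst := (convex_ball c r).is_const_of_fderivWithin_eq_zero (𝕜 := ℂ)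
    (f := fun z => F z * Complex.exp (-h z))
    (fun x hx => (hder x hx).differentiableAt.differentiableWithinAt)
    (fun x hx => by
      rw [fderivWithin_of_isOpen isOpen_ball hx]
      ext
      simpa using (hder x hx).deriv) hz (mem_ball_self hr)
  simp only [hc, ← hy, ← Complex.exp_add, add_neg_cancel, Complex.exp_zero] at hconst
  rw [Complex.exp_neg] at hconst
  field_simp at hconst
  simpa using hconst

theorem exists_norm_sub_le_cosh_two_mul_eq (ξ : ℂ) :
    ∃ (η : ℂ) (k : ℤ), ‖η - ξ‖ ≤ 3 ∧ Complex.cosh (2 * η) = 2 * k - 1 := by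
  obtain ⟨s, hs, hsx⟩ : ∃ s : ℝ, (s = 1 ∨ s = -1) ∧ ξ.re = s * |ξ.re| := by
    rcases le_total 0 ξ.re with h | h
    · exact ⟨1, .inl rfl, by simp [abs_of_nonneg h]⟩
    · exact ⟨-1, .inr rfl, by simp [abs_of_nonpos h]⟩
  set x := |ξ.re| with hx
  have hx0 : 0 ≤ x := abs_nonneg _
  have hgap : Real.cosh (2 * x) + 2 ≤ Real.cosh (2 * (x + 1)) := by
    have h1 : 2 * (x + 1) = 2 * x + 2 := by ring
    rw [h1, Real.cosh_add]
    have h2 : 3 ≤ Real.cosh 2 := by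
      have h4 := Real.quadratic_le_exp_of_nonneg (x := 2) (by norm_num)
      have h5 := Real.exp_pos (-2)
      have h6 := Real.add_one_le_exp (1 : ℝ)
      have h7 : Real.exp 2 = Real.exp 1 * Real.exp 1 := by rw [← Real.exp_add]; norm_num
      have h8 := Real.exp_one_gt_d9
      rw [Real.cosh_eq]
      nlinarith
    have h3 := Real.one_le_cosh (2 * x)
    have h4 : 0 ≤ Real.sinh (2 * x) * Real.sinh 2 :=
      mul_nonneg (Real.sinh_nonneg_iff.2 (by positivity)) (Real.sinh_nonneg_iff.2 (by norm_num))
    nlinarith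
  set k := ⌈(Real.cosh (2 * x) + 1) / 2⌉ with hk
  have hk1 : Real.cosh (2 * x) ≤ 2 * k - 1 := by
    have := Int.le_ceil ((Real.cosh (2 * x) + 1) / 2)
    linarith
  have hk2 : 2 * k - 1 ≤ Real.cosh (2 * (x + 1)) := by
    have := Int.ceil_lt_add_one ((Real.cosh (2 * x) + 1) / 2)
    linarith
  obtain ⟨a, ⟨ha1, ha2⟩, ha⟩ := intermediate_value_Icc (show x ≤ x + 1 by linarith)
    (f := fun x => Real.cosh (2 * x)) (by fun_prop) ⟨hk1, hk2⟩
  set m := round (ξ.im / Real.pi) with hm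
  refine ⟨(s * a : ℝ) + m * (Real.pi * Complex.I), k, ?_, ?_⟩
  · refine (Complex.norm_le_abs_re_add_abs_im _).trans ?_
    have hre : |s * a - ξ.re| ≤ 1 := by
      rw [hsx, ← mul_sub, abs_mul]
      have : |s| = 1 := by rcases hs with h | h <;> simp [h]
      rw [this, one_mul, abs_le]
      constructor <;> linarith
    have him : |m * Real.pi - ξ.im| ≤ 2 := by
      have h1 := abs_sub_round (ξ.im / Real.pi)
      have h2 : m * Real.pi - ξ.im = -((ξ.im / Real.pi - m) * Real.pi) := by
        field_simp
        ring
      rw [h2, abs_neg, abs_mul, abs_of_pos Real.pi_pos]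
      nlinarith [Real.pi_le_four, Real.pi_pos]
    have e1 : (((s * a : ℝ) : ℂ) + m * (Real.pi * Complex.I) - ξ).re = s * a - ξ.re := by simp
    have e2 : (((s * a : ℝ) : ℂ) + m * (Real.pi * Complex.I) - ξ).im = m * Real.pi - ξ.im := by
      simp
    rw [e1, e2]
    linarith
  · have h1 : Complex.cosh (2 * ((s * a : ℝ) + m * (Real.pi * Complex.I))) =
        Complex.cosh ((2 * (s * a) : ℝ)) := by
      have e1 : 2 * (((s * a : ℝ) : ℂ) + m * (Real.pi * Complex.I)) =
        ((2 * (s * a) : ℝ) : ℂ) + m * (2 * Real.pi * Complex.I) := by push_cast; ring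
      have e2 : -(2 * (((s * a : ℝ) : ℂ) + m * (Real.pi * Complex.I))) =
        -((2 * (s * a) : ℝ) : ℂ) + ((-m : ℤ) : ℂ) * (2 * Real.pi * Complex.I) := by
        push_cast; ring
      rw [Complex.cosh, e2, e1, Complex.exp_periodic.int_mul m _,
        Complex.exp_periodic.int_mul (-m) _, Complex.cosh]
    rw [h1, ← Complex.ofReal_cosh]
    have h2 : Real.cosh (2 * (s * a)) = 2 * k - 1 := by
      rw [← ha]
      rcases hs with h | h
      · simp [h]
      · simp [h]
    rw [h2]
    push_cast
    rfl

theorem norm_log_le {z : ℂ} {K : ℝ} (h1 : Real.exp (-K) ≤ ‖z‖) (h2 : ‖z‖ ≤ Real.exp K) :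
    ‖Complex.log z‖ ≤ K + 4 := by
  refine (Complex.norm_le_abs_re_add_abs_im _).trans ?_
  have hz : 0 < ‖z‖ := (Real.exp_pos _).trans_le h1
  have him : |(Complex.log z).im| ≤ 4 := by
    rw [Complex.log_im]
    exact (Complex.abs_arg_le_pi z).trans Real.pi_le_four
  have hre : |(Complex.log z).re| ≤ K := by
    rw [Complex.log_re, abs_le]
    exact ⟨(Real.le_log_iff_exp_le hz).2 h1, (Real.log_le_iff_le_exp hz).2 h2⟩
  linarith

/-- A function on a disc whose image misses the points with `cosh (2 * η)` an odd integer grows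
at most linearly, with a universal constant. -/
theorem norm_le_of_cosh_two_mul_ne {G : ℂ → ℂ} (hG : DifferentiableOn ℂ G (ball 0 8))
    (hne : ∀ z ∈ ball (0 : ℂ) 8, ∀ k : ℤ, Complex.cosh (2 * G z) ≠ 2 * k - 1) :
    ∀ z ∈ closedBall (0 : ℂ) 4, ‖G z‖ ≤ ‖G 0‖ + 192 := by
  have hsub : closedBall (0 : ℂ) 4 ⊆ ball 0 8 := closedBall_subset_ball (by norm_num)
  have hder : ∀ z ∈ closedBall (0 : ℂ) 4, ‖deriv G z‖ ≤ 48 := by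
    intro z hz
    have hz' : ball z 4 ⊆ ball 0 8 := ball_subset_ball' (by
      have := mem_closedBall.1 hz
      linarith)
    obtain ⟨v, hv⟩ := exists_ball_subset_image_ball (g := G) (c := z) (r := 3) (R := 4)
      (by norm_num) (by norm_num) (hG.mono hz')
    by_contra! hlt
    obtain ⟨η, k, hη, hk⟩ := exists_norm_sub_le_cosh_two_mul_eq v
    obtain ⟨x, hx, rfl⟩ := hv (show η ∈ _ by
      rw [mem_ball, dist_eq_norm]
      linarith)
    exact hne x (hz' (ball_subset_ball (by norm_num) hx)) k hk
  intro z hz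
  have h := (convex_closedBall (0 : ℂ) 4).norm_image_sub_le_of_norm_deriv_le
    (fun x hx => hG.differentiableAt (isOpen_ball.mem_nhds (hsub hx))) hder
    (mem_closedBall_self (by norm_num)) hz
  have h1 : ‖z - 0‖ ≤ 4 := mem_closedBall_iff_norm.1 hz
  have h2 := norm_sub_norm_le (G z) (G 0)
  linarith

/-- A weak form of **Schottky's theorem**. -/
theorem exists_norm_le_of_ne_zero_of_ne_one :
    ∃ C : ℝ, ∀ F : ℂ → ℂ, DifferentiableOn ℂ F (ball 0 8) →
      (∀ z ∈ ball (0 : ℂ) 8, F z ≠ 0 ∧ F z ≠ 1) → ‖F 0 + 1‖ ≤ 1 / 2 →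
      ∀ z ∈ closedBall (0 : ℂ) 4, ‖F z‖ ≤ C := by
  refine ⟨Real.exp (2 * Real.pi * Real.exp 396), fun F hF hne hF0 z hz => ?_⟩
  have h08 : (0 : ℂ) ∈ ball (0 : ℂ) 8 := mem_ball_self (by norm_num)
  have hz8 : z ∈ ball (0 : ℂ) 8 := closedBall_subset_ball (by norm_num) hz
  obtain ⟨H, hHd, hH0, hH⟩ := exists_eq_exp_of_ne_zero hF (fun z hz => (hne z hz).1)
    (Complex.log (F 0)) (Complex.exp_log (hne 0 h08).1)
  have hpi : (2 * Real.pi * Complex.I : ℂ) ≠ 0 := Complex.two_pi_I_ne_zero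
  have hnpi : ‖(2 * Real.pi * Complex.I : ℂ)‖ = 2 * Real.pi := by
    simp [abs_of_pos Real.pi_pos]
  set h : ℂ → ℂ := fun z => H z / (2 * Real.pi * Complex.I) with hh
  have hHh : ∀ z, H z = 2 * Real.pi * Complex.I * h z := fun z => by
    simp only [hh]
    field_simp
  have hhd : DifferentiableOn ℂ h (ball 0 8) := hHd.div_const _
  have hhne : ∀ z ∈ ball (0 : ℂ) 8, ∀ k : ℤ, h z ≠ k := by
    intro z hz k hk
    apply (hne z hz).2
    rw [hH z hz, hHh, hk, mul_comm, Complex.exp_int_mul_two_pi_mul_I]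
  have hh0 : ‖h 0‖ ≤ 1 := by
    have e1 : ‖F 0‖ ≤ 3 / 2 := by
      have := norm_sub_le (F 0 + 1) 1
      simp only [add_sub_cancel_right, norm_one] at this
      linarith
    have e2 : 1 / 2 ≤ ‖F 0‖ := by
      have := norm_sub_le (F 0 + 1) (F 0)
      simp only [add_sub_cancel_left, norm_one] at this
      linarith
    have e3 : ‖Complex.log (F 0)‖ ≤ 1 + 4 := by
      apply norm_log_le
      · refine le_trans ?_ e2
        rw [Real.exp_neg, one_div]
        exact inv_anti₀ (by norm_num) (by linarith [Real.add_one_le_exp (1 : ℝ)])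
      · linarith [Real.add_one_le_exp (1 : ℝ)]
    simp only [hh]
    rw [norm_div, hnpi, hH0, div_le_one (by positivity)]
    linarith [Real.pi_gt_three]
  obtain ⟨L₁, hL₁d, -, hL₁⟩ := exists_eq_exp_of_ne_zero hhd
    (fun z hz => by simpa using hhne z hz 0) (Complex.log (h 0))
    (Complex.exp_log (by simpa using hhne 0 h08 0))
  obtain ⟨L₂, hL₂d, -, hL₂⟩ := exists_eq_exp_of_ne_zero (hhd.sub_const 1)
    (fun z hz => sub_ne_zero.2 (by simpa using hhne z hz 1)) (Complex.log (h 0 - 1))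
    (Complex.exp_log (sub_ne_zero.2 (by simpa using hhne 0 h08 1)))
  set s₁ : ℂ → ℂ := fun z => Complex.exp (L₁ z / 2) with hs₁
  set s₂ : ℂ → ℂ := fun z => Complex.exp (L₂ z / 2) with hs₂
  have hsq₁ : ∀ z ∈ ball (0 : ℂ) 8, s₁ z ^ 2 = h z := fun z hz => by
    rw [hL₁ z hz, hs₁, ← Complex.exp_nat_mul]
    congr 1
    push_cast
    ring
  have hsq₂ : ∀ z ∈ ball (0 : ℂ) 8, s₂ z ^ 2 = h z - 1 := fun z hz => by
    rw [hL₂ z hz, hs₂, ← Complex.exp_nat_mul]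
    congr 1
    push_cast
    ring
  have hprod : ∀ z ∈ ball (0 : ℂ) 8, (s₁ z - s₂ z) * (s₁ z + s₂ z) = 1 := fun z hz => by
    linear_combination hsq₁ z hz - hsq₂ z hz
  have hs₁d : DifferentiableOn ℂ s₁ (ball 0 8) := (hL₁d.div_const 2).cexp
  have hs₂d : DifferentiableOn ℂ s₂ (ball 0 8) := (hL₂d.div_const 2).cexp
  have hsne : ∀ z ∈ ball (0 : ℂ) 8, s₁ z - s₂ z ≠ 0 := fun z hz h0 => by
    simpa [h0] using hprod z hz
  obtain ⟨G, hGd, hG0, hG⟩ := exists_eq_exp_of_ne_zero (hs₁d.sub hs₂d) hsne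
    (Complex.log (s₁ 0 - s₂ 0)) (Complex.exp_log (hsne 0 h08))
  have hcosh : ∀ z ∈ ball (0 : ℂ) 8, Complex.cosh (2 * G z) = 2 * h z - 1 := by
    intro z hz
    have e1 : Complex.exp (G z) = s₁ z - s₂ z := (hG z hz).symm
    have e2 : Complex.exp (-G z) = s₁ z + s₂ z := by
      rw [Complex.exp_neg, e1]
      exact inv_eq_of_mul_eq_one_right (hprod z hz)
    have e3 : Complex.exp (2 * G z) = (s₁ z - s₂ z) ^ 2 := by
      rw [← e1, ← Complex.exp_nat_mul]
      norm_num
    have e4 : Complex.exp (-(2 * G z)) = (s₁ z + s₂ z) ^ 2 := by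
      rw [← e2, ← Complex.exp_nat_mul]
      congr 1
      push_cast
      ring
    rw [Complex.cosh, e3, e4]
    linear_combination hsq₁ z hz + hsq₂ z hz
  have hG0n : ‖G 0‖ ≤ 6 := by
    have b₁ : ‖s₁ 0‖ ≤ 1 := by
      have := congrArg norm (hsq₁ 0 h08)
      rw [norm_pow] at this
      nlinarith [norm_nonneg (s₁ 0)]
    have b₂ : ‖s₂ 0‖ ≤ 2 := by
      have e := congrArg norm (hsq₂ 0 h08)
      rw [norm_pow] at e
      have := norm_sub_le (h 0) 1
      rw [norm_one] at this
      nlinarith [norm_nonneg (s₂ 0)]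
    have c₁ := norm_sub_le (s₁ 0) (s₂ 0)
    have c₂ := norm_add_le (s₁ 0) (s₂ 0)
    have c₃ := congrArg norm (hprod 0 h08)
    rw [norm_mul, norm_one] at c₃
    have hexp : 3 ≤ Real.exp 2 := by linarith [Real.add_one_le_exp (2 : ℝ)]
    have : ‖G 0‖ ≤ 2 + 4 := by
      rw [hG0]
      apply norm_log_le
      · have c₄ : (Real.exp 2)⁻¹ ≤ 3⁻¹ := inv_anti₀ (by norm_num) hexp
        rw [Real.exp_neg]
        nlinarith [norm_nonneg (s₁ 0 - s₂ 0)]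
      · linarith
    linarith
  have hGz : ‖G z‖ ≤ 198 := by
    have := norm_le_of_cosh_two_mul_ne hGd (fun z hz k hk => hhne z hz k (by
      rw [hcosh z hz] at hk
      linear_combination hk / 2)) z hz
    linarith
  have hhz : ‖h z‖ ≤ Real.exp 396 := by
    have e1 : ‖Complex.exp (2 * G z)‖ ≤ Real.exp 396 := by
      refine (Complex.norm_exp_le_exp_norm _).trans (Real.exp_le_exp.2 ?_)
      rw [norm_mul, Complex.norm_ofNat]
      linarith
    have e2 : ‖Complex.exp (-(2 * G z))‖ ≤ Real.exp 396 := by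
      refine (Complex.norm_exp_le_exp_norm _).trans (Real.exp_le_exp.2 ?_)
      rw [norm_neg, norm_mul, Complex.norm_ofNat]
      linarith
    have e3 : h z = (Complex.exp (2 * G z) + Complex.exp (-(2 * G z))) / 4 + 1 / 2 := by
      have := hcosh z hz8
      rw [Complex.cosh] at this
      linear_combination -this / 2
    have e4 : ‖h z‖ ≤ (Real.exp 396 + Real.exp 396) / 4 + 1 / 2 := by
      rw [e3]
      refine (norm_add_le _ _).trans ?_
      rw [norm_div, norm_div, Complex.norm_ofNat, norm_one, Complex.norm_ofNat]
      have := norm_add_le (Complex.exp (2 * G z)) (Complex.exp (-(2 * G z)))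
      linarith
    linarith [Real.add_one_le_exp (396 : ℝ)]
  rw [hH z hz8]
  refine (Complex.norm_exp_le_exp_norm _).trans (Real.exp_le_exp.2 ?_)
  rw [hHh, norm_mul, hnpi]
  gcongr

theorem norm_le_of_norm_le_on_circles {F : ℂ → ℂ} {r₁ r₂ C : ℝ}
    (hF : ∀ z : ℂ, r₁ ≤ ‖z‖ → DifferentiableAt ℂ F z)
    (h₁ : ∀ z : ℂ, ‖z‖ = r₁ → ‖F z‖ ≤ C) (h₂ : ∀ z : ℂ, ‖z‖ = r₂ → ‖F z‖ ≤ C)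
    {z : ℂ} (hz₁ : r₁ < ‖z‖) (hz₂ : ‖z‖ < r₂) : ‖F z‖ ≤ C := by
  set U : Set ℂ := {z | r₁ < ‖z‖ ∧ ‖z‖ < r₂} with hU
  have hUo : IsOpen U := (isOpen_lt continuous_const continuous_norm).inter
    (isOpen_lt continuous_norm continuous_const)
  have hcl : closure U ⊆ {z | r₁ ≤ ‖z‖ ∧ ‖z‖ ≤ r₂} := by
    refine closure_minimal (fun z hz => ⟨hz.1.le, hz.2.le⟩) ?_
    exact (isClosed_le continuous_const continuous_norm).inter
      (isClosed_le continuous_norm continuous_const)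
  have hbdd : Bornology.IsBounded U :=
    (isBounded_ball (x := (0 : ℂ)) (r := r₂)).subset fun z hz => by simpa using hz.2
  refine Complex.norm_le_of_forall_mem_frontier_norm_le hbdd (f := F)
    ⟨fun x hx => (hF x hx.1.le).differentiableWithinAt,
      fun x hx => (hF x (hcl hx).1).continuousAt.continuousWithinAt⟩ (fun x hx => ?_)
    (subset_closure (show z ∈ U from ⟨hz₁, hz₂⟩))
  rw [hUo.frontier_eq] at hx
  obtain ⟨e₁, e₂⟩ := hcl hx.1
  rcases e₁.eq_or_lt with h | h
  · exact h₁ x h.symm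
  rcases e₂.eq_or_lt with h' | h'
  · exact h₂ x h'
  exact absurd (show x ∈ U from ⟨h, h'⟩) hx.2

/-- **Great Picard theorem** at infinity, for the omitted values `0` and `1`: the singularity at
infinity is not essential, as the values of the function are not dense. -/
theorem exists_le_norm_sub_of_ne_zero_of_ne_one {F : ℂ → ℂ} {R : ℝ}
    (hF : ∀ z : ℂ, R < ‖z‖ → DifferentiableAt ℂ F z)
    (hne : ∀ z : ℂ, R < ‖z‖ → F z ≠ 0 ∧ F z ≠ 1) :
    ∃ (a : ℂ) (ε S : ℝ), 0 < ε ∧ ∀ z : ℂ, S < ‖z‖ → ε ≤ ‖F z - a‖ := by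
  obtain ⟨C, hC⟩ := exists_norm_le_of_ne_zero_of_ne_one
  by_contra! hdense
  set T := max R 1 with hT
  have hT1 : 1 ≤ T := le_max_right _ _
  have hcirc : ∀ z₁ : ℂ, Real.exp 8 * T < ‖z₁‖ → ‖F z₁ + 1‖ ≤ 1 / 2 →
      ∀ z : ℂ, ‖z‖ = ‖z₁‖ → ‖F z‖ ≤ C := by
    intro z₁ hz₁ hFz₁ z hz
    have hpos : 0 < ‖z₁‖ := lt_trans (by positivity) hz₁
    have hz₁0 : z₁ ≠ 0 := norm_pos_iff.1 hpos
    have hlarge : ∀ ζ ∈ ball (0 : ℂ) 8, R < ‖z₁ * Complex.exp ζ‖ := by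
      intro ζ hζ
      rw [norm_mul, Complex.norm_exp]
      have h1 : -8 ≤ ζ.re := by
        have := (abs_le.1 (Complex.abs_re_le_norm ζ)).1
        have := mem_ball_zero_iff.1 hζ
        linarith
      calc R ≤ T := le_max_left _ _
        _ = Real.exp 8 * T * Real.exp (-8) := by
          rw [mul_right_comm, ← Real.exp_add]; simp
        _ < ‖z₁‖ * Real.exp (-8) := by gcongr
        _ ≤ ‖z₁‖ * Real.exp ζ.re := by gcongr
    have key := hC (fun ζ => F (z₁ * Complex.exp ζ))
      (fun ζ hζ => ((hF _ (hlarge ζ hζ)).comp ζ (by fun_prop)).differentiableWithinAt)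
      (fun ζ hζ => hne _ (hlarge ζ hζ)) (by simpa using hFz₁) (Complex.log (z / z₁)) (by
        rw [mem_closedBall_zero_iff]
        have h1 : ‖z / z₁‖ = 1 := by rw [norm_div, hz, div_self hpos.ne']
        simpa using norm_log_le (z := z / z₁) (K := 0) (by rw [h1]; simp) (by rw [h1]; simp))
    have hz0 : z ≠ 0 := norm_pos_iff.1 (hz ▸ hpos)
    simpa [Complex.exp_log (div_ne_zero hz0 hz₁0), mul_div_cancel₀ _ hz₁0] using key
  obtain ⟨z₁, hz₁, hF₁⟩ := hdense (-1) (1 / 2) (Real.exp 8 * T) (by norm_num)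
  rw [sub_neg_eq_add] at hF₁
  obtain ⟨y, hy, hFy⟩ := hdense ((|C| + 1 : ℝ) : ℂ) 1 ‖z₁‖ one_pos
  obtain ⟨z₂, hz₂, hF₂⟩ := hdense (-1) (1 / 2) ‖y‖ (by norm_num)
  rw [sub_neg_eq_add] at hF₂
  have hexp : T ≤ Real.exp 8 * T := le_mul_of_one_le_left (by positivity) (by simp)
  have hle : ‖F y‖ ≤ C := norm_le_of_norm_le_on_circles
    (fun z hz => hF z (by linarith [le_max_left R 1])) (hcirc z₁ hz₁ hF₁.le)
    (hcirc z₂ (hz₁.trans (hy.trans hz₂)) hF₂.le) hy hz₂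
  have h3 := norm_sub_norm_le ((|C| + 1 : ℝ) : ℂ) (F y)
  rw [norm_sub_rev, Complex.norm_real, Real.norm_eq_abs, abs_of_pos (by positivity)] at h3
  linarith [le_abs_self C]

/-- **Great Picard theorem** at infinity. -/
theorem exists_le_norm_sub_of_forall_ne {f : ℂ → ℂ} {R : ℝ} {p w : ℂ} (hpw : p ≠ w)
    (hf : ∀ z : ℂ, R < ‖z‖ → DifferentiableAt ℂ f z)
    (hne : ∀ z : ℂ, R < ‖z‖ → f z ≠ p ∧ f z ≠ w) :
    ∃ (a : ℂ) (ε S : ℝ), 0 < ε ∧ ∀ z : ℂ, S < ‖z‖ → ε ≤ ‖f z - a‖ := by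
  have hd : w - p ≠ 0 := sub_ne_zero.2 hpw.symm
  obtain ⟨a, ε, S, hε, h⟩ := exists_le_norm_sub_of_ne_zero_of_ne_one
    (F := fun z => (f z - p) / (w - p)) (R := R)
    (fun z hz => ((hf z hz).sub_const p).div_const _)
    (fun z hz => ⟨div_ne_zero (sub_ne_zero.2 (hne z hz).1) hd, fun h => (hne z hz).2 (by
      rw [div_eq_one_iff_eq hd] at h
      exact sub_left_injective h)⟩)
  refine ⟨p + a * (w - p), ε * ‖w - p‖, S, mul_pos hε (norm_pos_iff.2 hd), fun z hz => ?_⟩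
  have e : f z - (p + a * (w - p)) = ((f z - p) / (w - p) - a) * (w - p) := by
    field_simp
    ring
  rw [e, norm_mul]
  exact mul_le_mul_of_nonneg_right (h z hz) (norm_nonneg _)

theorem exists_polynomial_of_norm_le_pow {E : ℂ → ℂ} (hE : Differentiable ℂ E) {C S : ℝ} {n : ℕ}
    (hb : ∀ z : ℂ, S < ‖z‖ → ‖E z‖ ≤ C * ‖z‖ ^ n) :
    ∃ Q : Polynomial ℂ, ∀ z, E z = Q.eval z := by
  have hzero : ∀ m, n < m → iteratedDeriv m E 0 = 0 := by
    intro m hm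
    have hle : ∀ᶠ R : ℝ in atTop, ‖iteratedDeriv m E 0‖ ≤ m.factorial * C * R⁻¹ ^ (m - n) := by
      filter_upwards [eventually_gt_atTop S, eventually_gt_atTop 0] with R hRS hR
      refine (Complex.norm_iteratedDeriv_le_of_forall_mem_sphere_norm_le m hR hE.diffContOnCl
        (C := C * R ^ n) (fun z hz => ?_)).trans_eq ?_
      · rw [mem_sphere_zero_iff_norm] at hz
        simpa [hz] using hb z (by rw [hz]; exact hRS)
      · obtain ⟨d, rfl⟩ := Nat.exists_eq_add_of_le hm.le
        rw [Nat.add_sub_cancel_left, pow_add, inv_pow]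
        field_simp
    have hlim : Tendsto (fun R : ℝ => m.factorial * C * R⁻¹ ^ (m - n)) atTop (𝓝 0) := by
      have := (tendsto_inv_atTop_zero (𝕜 := ℝ)).pow (m - n)
      rw [zero_pow (Nat.sub_ne_zero_of_lt hm)] at this
      simpa using this.const_mul (m.factorial * C)
    exact norm_le_zero_iff.1 (ge_of_tendsto hlim hle)
  refine ⟨∑ i ∈ Finset.range (n + 1),
    Polynomial.C ((i.factorial : ℂ)⁻¹ * iteratedDeriv i E 0) * Polynomial.X ^ i, fun z => ?_⟩
  have h1 := Complex.hasSum_taylorSeries_of_entire hE 0 z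
  have h2 := hasSum_sum_of_ne_finset_zero (s := Finset.range (n + 1))
    (f := fun n => ((n.factorial : ℂ))⁻¹ • (z - 0) ^ n • iteratedDeriv n E 0) (L := .unconditional ℕ)
    (fun i hi => by
      rw [hzero i (by simpa using hi)]
      simp)
  rw [h1.unique h2, Polynomial.eval_finsetSum]
  refine Finset.sum_congr rfl fun i _ => ?_
  simp
  ring

theorem meromorphicAt_of_bounded {g : ℂ → ℂ} {c : ℂ} {B : ℝ}
    (hd : ∀ᶠ z in 𝓝[≠] c, DifferentiableAt ℂ g z) (hb : ∀ᶠ z in 𝓝[≠] c, ‖g z‖ ≤ B) :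
    MeromorphicAt g c := by
  obtain ⟨s, hs, hsub⟩ := mem_nhdsWithin_iff_exists_mem_nhds_inter.1 (hd.and hb)
  have h := Complex.differentiableOn_update_limUnder_of_bddAbove hs
    (fun z hz => (hsub hz).1.differentiableWithinAt)
    ⟨B, by rintro _ ⟨z, hz, rfl⟩; exact (hsub hz).2⟩
  exact MeromorphicAt.update_iff.1 (h.analyticAt hs).meromorphicAt

theorem meromorphicAt_of_tendsto_norm_atTop {f : ℂ → ℂ} {q : ℂ}
    (hd : ∀ᶠ z in 𝓝[≠] q, DifferentiableAt ℂ f z)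
    (hf : Tendsto (fun z => ‖f z‖) (𝓝[≠] q) atTop) : MeromorphicAt f q := by
  rw [← MeromorphicAt.inv_iff]
  refine meromorphicAt_of_bounded (B := 1) ?_ ?_
  · filter_upwards [hd, hf.eventually_gt_atTop 0] with z hz h0
    exact hz.inv (norm_pos_iff.1 h0)
  · filter_upwards [hf.eventually_ge_atTop 1] with z h1
    rw [Pi.inv_apply, norm_inv]
    exact inv_le_one_of_one_le₀ h1

theorem Set.Finite.eventually_nhdsNE_notMem {P : Set ℂ} (hP : P.Finite) (q : ℂ) :
    ∀ᶠ z in 𝓝[≠] q, z ∉ P := by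
  have h : ∀ᶠ z in 𝓝 q, z ∉ P \ {q} := (hP.sdiff).isClosed.isOpen_compl.mem_nhds (by simp)
  filter_upwards [h.filter_mono nhdsWithin_le_nhds, self_mem_nhdsWithin] with z hz hne hzP
  exact hz ⟨hzP, hne⟩

theorem Set.Finite.analyticAt_of_notMem {f : ℂ → ℂ} {P : Set ℂ} (hPfin : P.Finite)
    (hdiff : ∀ z ∈ Pᶜ, DifferentiableAt ℂ f z) {z : ℂ} (hz : z ∉ P) : AnalyticAt ℂ f z :=
  Complex.analyticAt_iff_eventually_differentiableAt.2
    (Filter.mem_of_superset (hPfin.isClosed.isOpen_compl.mem_nhds hz) hdiff)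

/-- **Casorati-Weierstrass theorem** at infinity: a meromorphic function with finitely many poles
whose values near infinity are not dense is rational. -/
theorem exists_eq_eval_div_eval_of_le_norm_sub {f : ℂ → ℂ} {P : Set ℂ} (hPfin : P.Finite)
    (hdiff : ∀ z ∈ Pᶜ, DifferentiableAt ℂ f z)
    (hpole : ∀ q ∈ P, Tendsto (fun z => ‖f z‖) (𝓝[≠] q) atTop)
    {a : ℂ} {ε S : ℝ} (hε : 0 < ε) (hS : ∀ z : ℂ, S < ‖z‖ → ε ≤ ‖f z - a‖) :
    ∃ P₁ P₂ : Polynomial ℂ, P₂ ≠ 0 ∧ ∀ z ∈ Pᶜ, f z = P₁.eval z / P₂.eval z := by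
  have hmero : ∀ q ∈ P, MeromorphicAt f q := fun q hq =>
    meromorphicAt_of_tendsto_norm_atTop ((hPfin.eventually_nhdsNE_notMem q).mono hdiff) (hpole q hq)
  choose! n hn using hmero
  set s := hPfin.toFinset with hs
  set q : ℂ → ℂ := fun z => ∏ c ∈ s, (z - c) ^ n c with hq
  have hqdiff : ∀ t : Finset ℂ, Differentiable ℂ fun z : ℂ => ∏ c ∈ t, (z - c) ^ n c := fun t => by
    fun_prop
  have hE : Differentiable ℂ fun z => q z * f z := by
    intro z
    by_cases hz : z ∈ P
    · have h1 : (fun x => q x * f x) =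
          fun x => (∏ c ∈ s.erase z, (x - c) ^ n c) * ((x - z) ^ n z • f x) := by
        funext x
        simp only [hq]
        rw [← Finset.mul_prod_erase s _ (a := z) (by simpa [hs] using hz), smul_eq_mul]
        ring
      rw [h1]
      exact (hqdiff _ z).mul (hn z hz).differentiableAt
    · exact (hqdiff _ z).mul (hdiff z hz)
  have hcob : Tendsto (fun ζ : ℂ => ‖ζ⁻¹‖) (𝓝[≠] 0) atTop :=
    tendsto_norm_cobounded_atTop.comp tendsto_inv₀_nhdsNE_zero
  obtain ⟨B, hB⟩ := hPfin.isBounded.exists_norm_le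
  have hfinv : MeromorphicAt (fun ζ : ℂ => f ζ⁻¹) 0 := by
    have h1 : MeromorphicAt (fun ζ : ℂ => (f ζ⁻¹ - a)⁻¹) 0 := by
      refine meromorphicAt_of_bounded (B := ε⁻¹) ?_ ?_
      · filter_upwards [hcob.eventually_gt_atTop B, hcob.eventually_gt_atTop S,
          self_mem_nhdsWithin] with ζ h1 h2 h3
        refine DifferentiableAt.inv (((hdiff _ fun h => ?_).comp ζ
          (differentiableAt_inv h3)).sub_const a) (norm_pos_iff.1 (hε.trans_le (hS _ h2)))
        exact (hB _ h).not_gt h1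
      · filter_upwards [hcob.eventually_gt_atTop S] with ζ h2
        rw [norm_inv]
        exact inv_anti₀ hε (hS _ h2)
    have h2 := h1.inv.add (MeromorphicAt.const a 0)
    refine h2.congr (Eventually.of_forall fun ζ => ?_)
    simp
  have hEinv : MeromorphicAt (fun ζ : ℂ => q ζ⁻¹ * f ζ⁻¹) 0 := by
    refine MeromorphicAt.mul (f := fun ζ : ℂ => q ζ⁻¹) ?_ hfinv
    exact MeromorphicAt.fun_prod fun c _ =>
      (((MeromorphicAt.id 0).inv.sub (MeromorphicAt.const c 0)).pow (n c))
  obtain ⟨N, hN⟩ := hEinv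
  have hbound : ∀ᶠ ζ in 𝓝 (0 : ℂ), ‖(ζ - 0) ^ N • (q ζ⁻¹ * f ζ⁻¹)‖ ≤
      ‖((0 : ℂ) - 0) ^ N • (q (0 : ℂ)⁻¹ * f (0 : ℂ)⁻¹)‖ + 1 :=
    (hN.continuousAt.norm.eventually_lt_const (lt_add_one _)).mono fun _ h => h.le
  set C := ‖((0 : ℂ) - 0) ^ N • (q (0 : ℂ)⁻¹ * f (0 : ℂ)⁻¹)‖ + 1 with hC
  obtain ⟨δ, hδ, hball⟩ := Metric.eventually_nhds_iff.1 hbound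
  obtain ⟨Q, hQ⟩ := exists_polynomial_of_norm_le_pow hE (C := C) (S := δ⁻¹) (n := N) (by
    intro z hz
    have hz0 : 0 < ‖z‖ := (inv_pos.2 hδ).trans hz
    have h := hball (y := z⁻¹) (by
      rw [dist_zero_right, norm_inv]
      exact inv_lt_of_inv_lt₀ hδ hz)
    rw [sub_zero, inv_inv, norm_smul, norm_pow, norm_inv, inv_pow,
      inv_mul_le_iff₀ (by positivity)] at h
    linarith)
  refine ⟨Q, ∏ c ∈ s, (Polynomial.X - Polynomial.C c) ^ n c,
    Finset.prod_ne_zero_iff.2 fun c _ => pow_ne_zero _ (Polynomial.X_sub_C_ne_zero c), ?_⟩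
  intro z hz
  have heval : (∏ c ∈ s, (Polynomial.X - Polynomial.C c) ^ n c).eval z = q z := by
    simp [Polynomial.eval_prod, hq]
  have hqz : q z ≠ 0 := Finset.prod_ne_zero_iff.2 fun c hc => pow_ne_zero _ (sub_ne_zero.2 (by
    rintro rfl
    exact hz (by simpa [hs] using hc)))
  rw [heval, ← hQ, mul_div_cancel_left₀ _ hqz]

theorem nhds_le_map_of_not_rational {f : ℂ → ℂ} {P : Set ℂ} (hPfin : P.Finite)
    (hdiff : ∀ z ∈ Pᶜ, DifferentiableAt ℂ f z)
    (htrans : ¬ ∃ (P₁ P₂ : Polynomial ℂ), P₂ ≠ 0 ∧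
      ∀ z ∈ Pᶜ, f z = P₁.eval z / P₂.eval z) {z : ℂ} (hz : z ∉ P) :
    𝓝 (f z) ≤ map f (𝓝 z) := by
  refine (hPfin.analyticAt_of_notMem hdiff hz).eventually_constant_or_nhds_le_map_nhds.resolve_left
    fun hconst => htrans ⟨Polynomial.C (f z), 1, one_ne_zero, fun x hx => ?_⟩
  have hconn : IsPreconnected Pᶜ :=
    (hPfin.countable.isPathConnected_compl_of_one_lt_rank
      (by rw [Complex.rank_real_complex]; norm_num)).isConnected.isPreconnected
  have := AnalyticOnNhd.eqOn_of_preconnected_of_eventuallyEq (f := f) (g := fun _ => f z)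
    (fun y hy => hPfin.analyticAt_of_notMem hdiff hy) analyticOnNhd_const hconn hz hconst hx
  simpa using this

theorem exists_forall_lt_norm_exists_eq_of_pole {f : ℂ → ℂ} {P : Set ℂ} (hPfin : P.Finite)
    (hdiff : ∀ z ∈ Pᶜ, DifferentiableAt ℂ f z) {p : ℂ}
    (hpole : Tendsto (fun z => ‖f z‖) (𝓝[≠] p) atTop) {U : Set ℂ} (hU : U ∈ 𝓝 p) :
    ∃ R : ℝ, ∀ u : ℂ, R < ‖u‖ → ∃ v ∈ U, v ∉ P ∧ f v = u := by
  classical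
  set g := Function.update (fun z => (f z)⁻¹) p 0 with hg
  have hgp : g p = 0 := Function.update_self ..
  have hgne : ∀ z, z ≠ p → g z = (f z)⁻¹ := fun z hz => Function.update_of_ne hz ..
  have hgc : ContinuousAt g p := by
    rw [hg, continuousAt_update_same, tendsto_zero_iff_norm_tendsto_zero]
    simpa [Function.comp_def] using tendsto_inv_atTop_zero.comp hpole
  have hga : AnalyticAt ℂ g p := by
    refine Complex.analyticAt_of_differentiable_on_punctured_nhds_of_continuousAt ?_ hgc
    filter_upwards [hPfin.eventually_nhdsNE_notMem p, self_mem_nhdsWithin,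
      hpole.eventually_gt_atTop 0] with z hzP hzp hz0
    refine ((hdiff z hzP).inv (norm_pos_iff.1 hz0)).congr_of_eventuallyEq ?_
    filter_upwards [isOpen_ne.mem_nhds hzp] with x hx using hgne x hx
  have hopen : 𝓝 (g p) ≤ map g (𝓝 p) := by
    refine hga.eventually_constant_or_nhds_le_map_nhds.resolve_left fun hconst => ?_
    obtain ⟨z, ⟨hz0, hzp⟩, hz⟩ := (((hconst.filter_mono nhdsWithin_le_nhds).and
      (self_mem_nhdsWithin (a := p) (s := {p}ᶜ))).and (hpole.eventually_gt_atTop 0)).exists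
    rw [hgne z hzp, hgp, inv_eq_zero] at hz0
    simp [hz0] at hz
  have hW : U ∩ {z | z ≠ p → z ∉ P} ∈ 𝓝 p :=
    inter_mem hU (eventually_nhdsWithin_iff.1 (hPfin.eventually_nhdsNE_notMem p))
  have himg : g '' (U ∩ {z | z ≠ p → z ∉ P}) ∈ 𝓝 (0 : ℂ) := hgp ▸ hopen (image_mem_map hW)
  obtain ⟨δ, hδ, hball⟩ := Metric.mem_nhds_iff.1 himg
  refine ⟨δ⁻¹, fun u hu => ?_⟩
  obtain ⟨v, ⟨hvU, hvP⟩, hv⟩ := hball (show u⁻¹ ∈ ball (0 : ℂ) δ by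
    rw [mem_ball_zero_iff, norm_inv]
    exact inv_lt_of_inv_lt₀ hδ hu)
  have hu0 : u ≠ 0 := norm_pos_iff.1 ((inv_pos.2 hδ).trans hu)
  have hvp : v ≠ p := by
    rintro rfl
    exact inv_ne_zero hu0 (hv.symm.trans hgp)
  exact ⟨v, hvU, hvP hvp, inv_injective ((hgne v hvp).symm.trans hv)⟩

theorem continuousAt_iterate_of_forall_notMem {f : ℂ → ℂ} {P : Set ℂ}
    (hcont : ∀ z ∉ P, ContinuousAt f z) {x : ℂ} {N : ℕ} (hx : ∀ i < N, f^[i] x ∉ P) :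
    ∀ i ≤ N, ContinuousAt f^[i] x := by
  intro i hi
  induction i with
  | zero => exact continuousAt_id
  | succ i ih =>
    rw [Function.iterate_succ']
    exact (hcont _ (hx i hi)).comp (ih (by omega))

theorem nhds_iterate_le_map_of_forall_notMem {f : ℂ → ℂ} {P : Set ℂ}
    (hopen : ∀ z ∉ P, 𝓝 (f z) ≤ map f (𝓝 z)) {x : ℂ} {N : ℕ} (hx : ∀ i < N, f^[i] x ∉ P) :
    𝓝 (f^[N] x) ≤ map f^[N] (𝓝 x) := by
  induction N with
  | zero => simp
  | succ N ih =>
    rw [Function.iterate_succ', ← Filter.map_map]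
    exact (hopen _ (hx N (by omega))).trans (map_mono (ih fun i hi => hx i (by omega)))

theorem eventually_forall_iterate_notMem {f : ℂ → ℂ} {P : Set ℂ} (hP : IsClosed P)
    (hcont : ∀ z ∉ P, ContinuousAt f z) {x : ℂ} {N : ℕ} (hx : ∀ i < N, f^[i] x ∉ P) :
    ∀ᶠ z in 𝓝 x, ∀ i < N, f^[i] z ∉ P := by
  refine (Set.finite_lt_nat N).eventually_all.2 fun i hi => ?_
  exact (continuousAt_iterate_of_forall_notMem hcont hx i (le_of_lt hi)).eventually_mem
    (hP.isOpen_compl.mem_nhds (hx i hi))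

/-- Near a prepole `x` of order `N` there are prepoles whose orbit passes close to the pole at time
`N`, is large at time `N + 1`, and hits the pole again one or two steps later. -/
theorem exists_prepole_near {f : ℂ → ℂ} {P : Set ℂ} (hPfin : P.Finite)
    (hdiff : ∀ z ∈ Pᶜ, DifferentiableAt ℂ f z)
    (hpole : ∀ q ∈ P, Tendsto (fun z => ‖f z‖) (𝓝[≠] q) atTop)
    (htrans : ¬ ∃ (P₁ P₂ : Polynomial ℂ), P₂ ≠ 0 ∧
      ∀ z ∈ Pᶜ, f z = P₁.eval z / P₂.eval z)
    {p w : ℂ} (hp : p ∈ P) (hw : w ∉ P) (hwp : f w = p) {x : ℂ} {N : ℕ} (hxp : f^[N] x = p)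
    (hx : ∀ i < N, f^[i] x ∉ P) {U : Set ℂ} (hU : U ∈ 𝓝 x) {ε : ℝ} (hε : 0 < ε) (ρ : ℝ) :
    ∃ x' ∈ U, ∃ N', N + 2 ≤ N' ∧ N' ≤ N + 3 ∧ f^[N'] x' = p ∧ (∀ i < N', f^[i] x' ∉ P) ∧
      dist (f^[N] x') p < ε ∧ ρ < ‖f^[N + 1] x'‖ := by
  have hopen : ∀ z ∉ P, 𝓝 (f z) ≤ map f (𝓝 z) := fun z hz =>
    nhds_le_map_of_not_rational hPfin hdiff htrans hz
  have hcont : ∀ z ∉ P, ContinuousAt f z := fun z hz => (hdiff z hz).continuousAt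
  have hV : f^[N] '' (U ∩ {z | ∀ i < N, f^[i] z ∉ P}) ∈ 𝓝 p :=
    hxp ▸ nhds_iterate_le_map_of_forall_notMem hopen hx (image_mem_map
      (inter_mem hU (eventually_forall_iterate_notMem hPfin.isClosed hcont hx)))
  obtain ⟨R, hR⟩ := exists_forall_lt_norm_exists_eq_of_pole hPfin hdiff (hpole p hp)
    (inter_mem hV (ball_mem_nhds p hε))
  obtain ⟨B, hB⟩ := hPfin.isBounded.exists_norm_le
  obtain ⟨u, hu, hfu⟩ : ∃ u : ℂ, max (max R ρ) B < ‖u‖ ∧ (f u = p ∨ f u = w) := by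
    by_contra! hne
    obtain ⟨a, δ, S, hδ, hS⟩ := exists_le_norm_sub_of_forall_ne
      (show p ≠ w from fun h => hw (h ▸ hp))
      (fun z hz => hdiff z fun h => (hB z h).not_gt ((le_max_right _ _).trans_lt hz)) hne
    exact htrans (exists_eq_eval_div_eval_of_le_norm_sub hPfin hdiff hpole hδ hS)
  simp only [max_lt_iff] at hu
  have huP : u ∉ P := fun h => (hB u h).not_gt hu.2
  obtain ⟨v, ⟨⟨x', ⟨hx'U, hx'⟩, rfl⟩, hvε⟩, hvP, hvu⟩ := hR u hu.1.1
  rw [← Function.iterate_succ_apply' f N x'] at hvu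
  have hbase : ∀ i < N + 2, f^[i] x' ∉ P := by
    intro i hi
    rcases Nat.lt_or_ge i N with h | h
    · exact hx' i h
    · obtain rfl | rfl : i = N ∨ i = N + 1 := by omega
      · exact hvP
      · rwa [hvu]
  rcases hfu with hfu | hfu
  · refine ⟨x', hx'U, N + 2, le_rfl, by omega, ?_, hbase, hvε, by rw [hvu]; exact hu.1.2⟩
    rw [Function.iterate_succ_apply', hvu, hfu]
  · have hN2 : f^[N + 2] x' = w := by rw [Function.iterate_succ_apply', hvu, hfu]
    refine ⟨x', hx'U, N + 3, by omega, le_rfl, ?_, fun i hi => ?_, hvε, by rw [hvu]; exact hu.1.2⟩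
    · rw [Function.iterate_succ_apply', hN2, hwp]
    · rcases Nat.lt_succ_iff_lt_or_eq.1 hi with h | rfl
      · exact hbase i h
      · rwa [hN2]

/-- Let `f` be transcendental meromorphic on `ℂ` with finite nonempty pole
set `P`, and let `p ∈ P` be a pole that is not an omitted value. Then for every sequence
`(ρ k)` of reals there is a point `z₀` with defined orbit, a bound `M`, and bounded-gap
subsequences `(m k)`, `(n k)` with `m k < n k < m (k+1)`, such that `f^[m k] z₀ → p`,
`‖f^[n k] z₀‖ → ∞`, and `‖f^[n k] z₀‖ ≥ ρ k` for all `k`: a ping-pong orbit whose escaping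
subsequence escapes arbitrarily fast. -/
theorem ping_pong_orbit_arbitrarily_fast
    (f : ℂ → ℂ) (P : Set ℂ) (hPfin : P.Finite) (hPne : P.Nonempty)
    (hdiff : ∀ z ∈ Pᶜ, DifferentiableAt ℂ f z)
    (hpole : ∀ q ∈ P,
      Filter.Tendsto (fun z => ‖f z‖) (nhdsWithin q {q}ᶜ) Filter.atTop)
    (htrans : ¬ ∃ (P₁ P₂ : Polynomial ℂ), P₂ ≠ 0 ∧
      ∀ z ∈ Pᶜ, f z = P₁.eval z / P₂.eval z)
    (p : ℂ) (hp : p ∈ P)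
    (hnotomitted : ∃ w ∈ Pᶜ, f w = p) :
    ∀ ρ : ℕ → ℝ,
      ∃ (z₀ : ℂ) (M : ℕ) (m n : ℕ → ℕ),
        (∀ k : ℕ, f^[k] z₀ ∉ P) ∧
        StrictMono m ∧ StrictMono n ∧
        (∀ k, m k < n k) ∧ (∀ k, n k < m (k + 1)) ∧
        (∀ k, n k - m k ≤ M) ∧ (∀ k, m (k + 1) - n k ≤ M) ∧
        Filter.Tendsto (fun k => f^[m k] z₀) Filter.atTop (nhds p) ∧
        Filter.Tendsto (fun k => ‖f^[n k] z₀‖) Filter.atTop Filter.atTop ∧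
        (∀ k, ρ k ≤ ‖f^[n k] z₀‖) := by
  intro ρ
  obtain ⟨w, hw, hwp⟩ := hnotomitted
  have hcont : ∀ z ∉ P, ContinuousAt f z := fun z hz => (hdiff z hz).continuousAt
  let State := {s : ℂ × ℕ × ℝ // f^[s.2.1] s.1 = p ∧ (∀ i < s.2.1, f^[i] s.1 ∉ P) ∧ 0 < s.2.2}
  have hstep : ∀ (k : ℕ) (s : State), ∃ s' : State,
      closedBall s'.1.1 s'.1.2.2 ⊆ closedBall s.1.1 s.1.2.2 ∧
      s.1.2.1 + 2 ≤ s'.1.2.1 ∧ s'.1.2.1 ≤ s.1.2.1 + 3 ∧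
      ∀ z ∈ closedBall s'.1.1 s'.1.2.2, (∀ i < s'.1.2.1, f^[i] z ∉ P) ∧
        dist (f^[s.1.2.1] z) p < 1 / ((k : ℝ) + 1) ∧ max (ρ k) k < ‖f^[s.1.2.1 + 1] z‖ := by
    rintro k ⟨⟨x, N, r⟩, hxp, hx, hr⟩
    obtain ⟨x', hx'U, N', hN₁, hN₂, hx'p, hx', hd, hlarge⟩ := exists_prepole_near hPfin hdiff hpole
      htrans hp hw hwp hxp hx (ball_mem_nhds x hr) (ε := 1 / ((k : ℝ) + 1)) (by positivity)
      (max (ρ k) k)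
    dsimp only at hN₁ hN₂
    have hc := continuousAt_iterate_of_forall_notMem hcont hx'
    have hev : ∀ᶠ z in 𝓝 x', z ∈ closedBall x r ∧ (∀ i < N', f^[i] z ∉ P) ∧
        dist (f^[N] z) p < 1 / ((k : ℝ) + 1) ∧ max (ρ k) k < ‖f^[N + 1] z‖ :=
      Filter.Eventually.and (mem_of_superset (isOpen_ball.mem_nhds hx'U) ball_subset_closedBall)
        ((eventually_forall_iterate_notMem hPfin.isClosed hcont hx').and
          ((((hc N (by omega)).dist continuousAt_const).eventually_lt_const hd).and
            ((hc (N + 1) (by omega)).norm.eventually_const_lt hlarge)))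
    obtain ⟨r', hr', hball⟩ := Metric.nhds_basis_closedBall.mem_iff.1 hev
    exact ⟨⟨⟨x', N', r'⟩, hx'p, hx', hr'⟩, fun z hz => (hball hz).1, hN₁, hN₂,
      fun z hz => (hball hz).2⟩
  choose next hsub hlo hhi hprop using hstep
  let σ : ℕ → State := fun k => Nat.rec ⟨⟨p, 0, 1⟩, rfl, by simp, one_pos⟩ next k
  let N : ℕ → ℕ := fun k => (σ k).1.2.1
  let K : ℕ → Set ℂ := fun k => closedBall (σ k).1.1 (σ k).1.2.2
  obtain ⟨z₀, hz₀⟩ := IsCompact.nonempty_iInter_of_sequence_nonempty_isCompact_isClosed K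
    (fun k => hsub k (σ k)) (fun k => nonempty_closedBall.2 (σ k).2.2.2.le)
    (isCompact_closedBall _ _) (fun k => isClosed_closedBall)
  rw [mem_iInter] at hz₀
  have hlo' : ∀ k, N k + 2 ≤ N (k + 1) := fun k => hlo k (σ k)
  have hhi' : ∀ k, N (k + 1) ≤ N k + 3 := fun k => hhi k (σ k)
  have hmono : StrictMono N := strictMono_nat_of_lt_succ fun k => by have := hlo' k; omega
  have hz : ∀ k, (∀ i < N (k + 1), f^[i] z₀ ∉ P) ∧ dist (f^[N k] z₀) p < 1 / ((k : ℝ) + 1) ∧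
      max (ρ k) k < ‖f^[N k + 1] z₀‖ := fun k => hprop k (σ k) z₀ (hz₀ (k + 1))
  refine ⟨z₀, 2, N, fun k => N k + 1, fun k => ?_, hmono, fun a b hab => ?_, fun k => ?_,
    fun k => ?_, fun k => ?_, fun k => ?_, ?_, ?_, fun k => ?_⟩
  · exact (hz k).1 k (hmono.le_apply.trans_lt (hmono k.lt_succ_self))
  · exact Nat.succ_lt_succ (hmono hab)
  · exact Nat.lt_succ_self _
  · exact hlo' k
  · simp
  · have := hhi' k
    simp only
    omega
  · exact tendsto_iff_dist_tendsto_zero.2 (squeeze_zero (fun _ => dist_nonneg)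
      (fun k => (hz k).2.1.le) tendsto_one_div_add_atTop_nhds_zero_nat)
  · exact tendsto_atTop_mono (fun k => ((le_max_right _ _).trans_lt (hz k).2.2).le)
      tendsto_natCast_atTop_atTop
  · exact ((le_max_left _ _).trans_lt (hz k).2.2).le
end
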